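/- Let A be a nontrivial finite abelian group and suppose that F is algebraically closed of characteristic not dividing |A|. Then σ(A) = exp(A), the exponent of A (the least common multiple of the orders of the elements of A); that is, σ(A,V) ≤ exp(A) for every A-module V, and there exists an A-module V with σ(A,V) = exp(A). -/

import Mathlib

open scoped ENNReal


open MvPolynomial

/-- The (right) action of a group element `g` on the coordinate ring `F[V]` of `V = ι → F`,
determined by `(f^g)(v) = f (g • v)` where `g` acts on `V` through the representation `ρ`. -/
noncomputable def polyAct {F : Type*} [Field F] {G : Type*} [Group G] {ι : Type*}
    [Fintype ι] [DecidableEq ι] (ρ : Representation F G (ι → F)) (g : G) :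
    MvPolynomial ι F →ₐ[F] MvPolynomial ι F :=
  MvPolynomial.aeval (fun i => ∑ j, (ρ g (Pi.single j 1) i) • MvPolynomial.X j)

/-- The ring of polynomial invariants `F[V]^G`. -/
noncomputable def invRing {F : Type*} [Field F] {G : Type*} [Group G] {ι : Type*}
    [Fintype ι] [DecidableEq ι] (ρ : Representation F G (ι → F)) :
    Subalgebra F (MvPolynomial ι F) :=
  ⨅ g : G, AlgHom.equalizer (polyAct ρ g) (AlgHom.id F (MvPolynomial ι F))

/-- The degree `d` homogeneous component of a graded subalgebra `S` of the polynomial ring,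
as a subspace of the polynomial ring. -/
noncomputable def subComp {F : Type*} [Field F] {ι : Type*} (S : Subalgebra F (MvPolynomial ι F)) (d : ℕ) :
    Submodule F (MvPolynomial ι F) :=
  Subalgebra.toSubmodule S ⊓ homogeneousSubmodule ι F d

/-- `S_+`, the span of the homogeneous elements of positive degree of `S`. -/
noncomputable def subPos {F : Type*} [Field F] {ι : Type*} (S : Subalgebra F (MvPolynomial ι F)) :
    Submodule F (MvPolynomial ι F) :=
  ⨆ d ∈ Set.Ioi (0 : ℕ), subComp S d

/-- `β_k(S)`, the top degree of `S_+ / S_+^{k+1}`, i.e. the supremum (in `ℕ∞`) of the degrees `d`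
such that the degree `d` component of `S_+` is not contained in `S_+^{k+1}`. -/
noncomputable def betaAlg {F : Type*} [Field F] {ι : Type*}
    (S : Subalgebra F (MvPolynomial ι F)) (k : ℕ) : ℕ∞ :=
  sSup ((fun d : ℕ => (d : ℕ∞)) '' {d | 0 < d ∧ ¬ subComp S d ≤ subPos S ^ (k + 1)})

/-- `β_k(F[V], S)`, the top degree of `F[V]/S_+^k F[V]`, i.e. the supremum (in `ℕ∞`) of the
degrees `d` such that the degree `d` component of the polynomial ring is not contained in
`S_+^k ⬝ F[V]`. -/
noncomputable def betaMod {F : Type*} [Field F] {ι : Type*}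
    (S : Subalgebra F (MvPolynomial ι F)) (k : ℕ) : ℕ∞ :=
  sSup ((fun d : ℕ => (d : ℕ∞)) ''
    {d | ¬ homogeneousSubmodule ι F d ≤ subPos S ^ k * (⊤ : Submodule F (MvPolynomial ι F))})

/-- `β_k(G)`, the supremum over all finite dimensional `G`-modules `V` of `β_k(F[V]^G)`. -/
noncomputable def betaGrp (F : Type*) [Field F] (G : Type*) [Group G] (k : ℕ) : ℕ∞ :=
  ⨆ (n : ℕ) (ρ : Representation F G (Fin n → F)), betaAlg (invRing ρ) k

/-- `S` is a finitely generated module over its subalgebra `T`. -/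
noncomputable def fgOver {F : Type*} [Field F] {ι : Type*} (S T : Subalgebra F (MvPolynomial ι F)) : Prop :=
  ∃ B : Finset (MvPolynomial ι F), (B : Set (MvPolynomial ι F)) ⊆ S ∧
    Subalgebra.toSubmodule S ≤ Subalgebra.toSubmodule T * Submodule.span F (B : Set (MvPolynomial ι F))

/-- `σ(S)`: the minimal `d` such that `S` is a finitely generated module over the subalgebra
`F[S_{≤ d}]` generated by the homogeneous elements of `S` of degree at most `d`. -/
noncomputable def sigmaAlg {F : Type*} [Field F] {ι : Type*}
    (S : Subalgebra F (MvPolynomial ι F)) : ℕ :=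
  sInf {d : ℕ | fgOver S (Algebra.adjoin F (⋃ i ∈ Set.Iic d, (subComp S i : Set (MvPolynomial ι F))))}

/-- `σ(G)`, the supremum over all finite dimensional `G`-modules `V` of `σ(F[V]^G)`. -/
noncomputable def sigmaGrp (F : Type*) [Field F] (G : Type*) [Group G] : ℕ∞ :=
  ⨆ (n : ℕ) (ρ : Representation F G (Fin n → F)), (sigmaAlg (invRing ρ) : ℕ∞)

/-- An irreducible (simple, nonzero) representation. -/
def IsIrredRep {F : Type*} [Field F] {G : Type*} [Group G] {V : Type*}
    [AddCommGroup V] [Module F V] (π : Representation F G V) : Prop :=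
  Nontrivial V ∧ ∀ W : Submodule F V, (∀ g : G, ∀ x ∈ W, π g x ∈ W) → W = ⊥ ∨ W = ⊤

section SigmaHelpers

theorem polyAct_X' {F : Type*} [Field F] {G : Type*} [Group G] {ι : Type*}
    [Fintype ι] [DecidableEq ι] (ρ : Representation F G (ι → F)) (g : G) (i : ι) :
    polyAct ρ g (X i) = ∑ j, (ρ g (Pi.single j 1) i) • MvPolynomial.X j := by
  simp [polyAct]

theorem polyAct_mul_X {F : Type*} [Field F] {G : Type*} [Group G] {ι : Type*}
    [Fintype ι] [DecidableEq ι] (ρ : Representation F G (ι → F)) (g h : G) (i : ι) :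
    polyAct ρ g (polyAct ρ h (X i)) = polyAct ρ (h * g) (X i) := by
  simp only [polyAct_X', map_sum, map_smul, Finset.smul_sum, smul_smul]
  rw [Finset.sum_comm]
  refine Finset.sum_congr rfl fun k _ => ?_
  rw [← Finset.sum_smul]
  congr 1
  rw [map_mul, Module.End.mul_apply]
  conv_rhs => rw [pi_eq_sum_univ' (ρ g (Pi.single k 1))]
  rw [map_sum, Finset.sum_apply]
  refine Finset.sum_congr rfl fun j _ => ?_
  rw [map_smul, Pi.smul_apply, smul_eq_mul, mul_comm]

theorem mem_invRing {F : Type*} [Field F] {G : Type*} [Group G] {ι : Type*}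
    [Fintype ι] [DecidableEq ι] (ρ : Representation F G (ι → F)) (f : MvPolynomial ι F) :
    f ∈ invRing ρ ↔ ∀ g, polyAct ρ g f = f := by
  simp [invRing, Algebra.mem_iInf, AlgHom.mem_equalizer]

/-- Projection of a variable to the isotypic component of a character. -/
noncomputable def eigForm {F : Type*} [Field F] {A : Type*} [CommGroup A] [Fintype A] {ι : Type*}
    [Fintype ι] [DecidableEq ι] (ρ : Representation F A (ι → F)) (χ : A →* Fˣ) (i : ι) :
    MvPolynomial ι F :=
  ∑ a, ((χ a)⁻¹ : Fˣ).val • polyAct ρ a (X i)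

theorem polyAct_eigForm {F : Type*} [Field F] {A : Type*} [CommGroup A] [Fintype A] {ι : Type*}
    [Fintype ι] [DecidableEq ι] (ρ : Representation F A (ι → F)) (χ : A →* Fˣ) (i : ι) (b : A) :
    polyAct ρ b (eigForm ρ χ i) = (χ b).val • eigForm ρ χ i := by
  simp only [eigForm, map_sum, map_smul, polyAct_mul_X, Finset.smul_sum, smul_smul]
  refine Fintype.sum_equiv (Equiv.mulRight b) _ _ fun a => ?_
  simp [mul_comm]

theorem eigForm_homog {F : Type*} [Field F] {A : Type*} [CommGroup A] [Fintype A] {ι : Type*}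
    [Fintype ι] [DecidableEq ι] (ρ : Representation F A (ι → F)) (χ : A →* Fˣ) (i : ι) :
    (eigForm ρ χ i).IsHomogeneous 1 := by
  rw [← mem_homogeneousSubmodule]
  refine Submodule.sum_mem _ fun a _ => Submodule.smul_mem _ _ ?_
  rw [polyAct_X']
  exact Submodule.sum_mem _ fun j _ => Submodule.smul_mem _ _ (isHomogeneous_X _ _)

theorem enough_roots {F : Type*} [Field F] [IsAlgClosed F]
    {A : Type*} [CommGroup A] [Finite A] (hA : (Nat.card A : F) ≠ 0) :
    HasEnoughRootsOfUnity F (Monoid.exponent A) := by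
  have : NeZero ((Monoid.exponent A : ℕ) : F) := ⟨fun h => hA (by
    obtain ⟨k, hk⟩ := Group.exponent_dvd_nat_card (G := A)
    rw [hk, Nat.cast_mul, h, zero_mul])⟩
  infer_instance

theorem sum_chars {F : Type*} [Field F] [IsAlgClosed F]
    {A : Type*} [CommGroup A] [Finite A] (hA : (Nat.card A : F) ≠ 0) [Fintype (A →* Fˣ)]
    (a : A) (ha : a ≠ 1) : ∑ χ : A →* Fˣ, ((χ a)⁻¹ : Fˣ).val = 0 := by
  have := enough_roots hA
  obtain ⟨φ, hφ⟩ := CommGroup.exists_apply_ne_one_of_hasEnoughRootsOfUnity A F ha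
  have h : (φ a : Fˣ).val * ∑ χ : A →* Fˣ, ((χ a)⁻¹ : Fˣ).val
      = ∑ χ : A →* Fˣ, ((χ a)⁻¹ : Fˣ).val := by
    rw [Finset.mul_sum]
    refine Fintype.sum_equiv (Equiv.mulRight φ⁻¹) _ _ fun χ => ?_
    simp [mul_comm]
  by_contra h0
  apply hφ
  ext
  simpa using (mul_eq_right₀ h0).1 h

theorem finite_chars {F : Type*} [Field F] [IsAlgClosed F]
    {A : Type*} [CommGroup A] [Finite A] (hA : (Nat.card A : F) ≠ 0) :
    Nonempty ((A →* Fˣ) ≃* A) := by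
  have := enough_roots hA
  exact CommGroup.monoidHom_mulEquiv_of_hasEnoughRootsOfUnity A F

theorem sum_eigForm {F : Type*} [Field F] [IsAlgClosed F] {A : Type*} [CommGroup A] [Fintype A]
    (hA : (Nat.card A : F) ≠ 0) [Fintype (A →* Fˣ)] {ι : Type*}
    [Fintype ι] [DecidableEq ι] (ρ : Representation F A (ι → F)) (i : ι) :
    ∑ χ : A →* Fˣ, eigForm ρ χ i = (Nat.card A : F) • X i := by
  simp only [eigForm]
  rw [Finset.sum_comm]
  simp only [← Finset.sum_smul]
  rw [Finset.sum_eq_single 1]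
  · obtain ⟨e⟩ := finite_chars (F := F) hA
    have h1 : polyAct ρ 1 (X i : MvPolynomial ι F) = X i := by
      rw [polyAct_X', Finset.sum_eq_single i]
      · simp
      · intro b _ hb
        simp [Pi.single_apply, hb.symm]
      · simp
    rw [h1, ← Nat.card_congr e.toEquiv]
    simp
  · intro a _ ha
    rw [sum_chars hA a ha, zero_smul]
  · simp

theorem eigForm_pow_mem {F : Type*} [Field F] {A : Type*} [CommGroup A] [Fintype A] {ι : Type*}
    [Fintype ι] [DecidableEq ι] (ρ : Representation F A (ι → F)) (χ : A →* Fˣ) (i : ι) :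
    eigForm ρ χ i ^ Monoid.exponent A ∈ subComp (invRing ρ) (Monoid.exponent A) := by
  refine ⟨?_, ?_⟩
  · change _ ∈ invRing ρ
    rw [mem_invRing]
    intro g
    rw [map_pow, polyAct_eigForm, smul_pow, ← Units.val_pow_eq_pow_val, ← map_pow,
      Monoid.pow_exponent_eq_one]
    simp
  · have := (eigForm_homog ρ χ i).pow (Monoid.exponent A)
    rw [one_mul] at this
    exact this

theorem fgOver_exponent {F : Type*} [Field F] [IsAlgClosed F] {A : Type*} [CommGroup A] [Finite A]
    (hA : (Nat.card A : F) ≠ 0) {ι : Type*}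
    [Fintype ι] [DecidableEq ι] (ρ : Representation F A (ι → F)) :
    fgOver (invRing ρ) (Algebra.adjoin F (⋃ i ∈ Set.Iic (Monoid.exponent A),
      (subComp (invRing ρ) i : Set (MvPolynomial ι F)))) := by
  classical
  have : Fintype A := Fintype.ofFinite A
  obtain ⟨e⟩ := finite_chars (F := F) hA
  have : Finite (A →* Fˣ) := Finite.of_equiv _ e.toEquiv.symm
  have : Fintype (A →* Fˣ) := Fintype.ofFinite _
  set R : Set (MvPolynomial ι F) :=
    Set.range fun p : (A →* Fˣ) × ι => eigForm ρ p.1 p.2 ^ Monoid.exponent A with hR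
  set T' := Algebra.adjoin F R with hT'
  have hTS : T' ≤ invRing ρ := by
    refine Algebra.adjoin_le ?_
    rintro _ ⟨p, rfl⟩
    exact (eigForm_pow_mem ρ p.1 p.2).1
  have hTT : T' ≤ Algebra.adjoin F (⋃ i ∈ Set.Iic (Monoid.exponent A),
      (subComp (invRing ρ) i : Set (MvPolynomial ι F))) := by
    refine Algebra.adjoin_mono ?_
    rintro _ ⟨p, rfl⟩
    exact Set.mem_biUnion (Set.mem_Iic.2 le_rfl) (eigForm_pow_mem ρ p.1 p.2)
  have hfg : T'.FG := Subalgebra.fg_def.2 ⟨R, Set.finite_range _, rfl⟩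
  have hft : Algebra.FiniteType F T' := T'.fg_iff_finiteType.1 hfg
  have hN : IsNoetherianRing T' := Algebra.FiniteType.isNoetherianRing F T'
  have hft2 : Algebra.FiniteType T' (MvPolynomial ι F) :=
    Algebra.FiniteType.of_restrictScalars_finiteType F T' (MvPolynomial ι F)
  have hy : ∀ χ i, IsIntegral T' (eigForm ρ χ i) := by
    intro χ i
    refine IsIntegral.of_pow (n := Monoid.exponent A) ?_ ?_
    · exact Nat.pos_of_ne_zero Monoid.exponent_ne_zero_of_finite
    · exact isIntegral_algebraMap
        (x := (⟨_, Algebra.subset_adjoin ⟨(χ, i), rfl⟩⟩ : T'))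
  have hX : ∀ i, IsIntegral T' (X i : MvPolynomial ι F) := by
    intro i
    have h1 : (X i : MvPolynomial ι F) = ((Nat.card A : F)⁻¹) • ∑ χ : A →* Fˣ, eigForm ρ χ i := by
      rw [sum_eigForm hA, smul_smul, inv_mul_cancel₀ hA, one_smul]
    rw [h1]
    exact IsIntegral.smul _ (IsIntegral.sum _ fun χ _ => hy χ i)
  have hint : Algebra.IsIntegral T' (MvPolynomial ι F) := by
    refine ⟨fun f => ?_⟩
    induction f using MvPolynomial.induction_on with
    | C a => exact isIntegral_algebraMap (R := T') (x := algebraMap F T' a)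
    | add p q hp hq => exact hp.add hq
    | mul_X p i hp => exact hp.mul (hX i)
  have hfin : Module.Finite T' (MvPolynomial ι F) := Algebra.IsIntegral.finite
  let S' : Submodule T' (MvPolynomial ι F) :=
    { carrier := invRing ρ
      add_mem' := fun ha hb => add_mem ha hb
      zero_mem' := zero_mem _
      smul_mem' := fun c x hx => (invRing ρ).mul_mem (hTS c.2) hx }
  obtain ⟨B, hB⟩ := (inferInstance : IsNoetherian T' (MvPolynomial ι F)).noetherian S'
  refine ⟨B, ?_, ?_⟩
  · intro b hb
    have : b ∈ S' := hB ▸ Submodule.subset_span hb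
    exact this
  · intro s hs
    have hs' : s ∈ Submodule.span T' (B : Set (MvPolynomial ι F)) := by
      rw [hB]; exact hs
    clear hs
    induction hs' using Submodule.closure_induction with
    | zero => exact zero_mem _
    | add x y _ _ hx hy => exact add_mem hx hy
    | smul_mem r x hx =>
      exact Submodule.mul_mem_mul (hTT r.2) (Submodule.subset_span hx)

/-- The one-dimensional representation given by a character. -/
noncomputable def charRep {F : Type*} [Field F] {A : Type*} [CommGroup A] (χ : A →* Fˣ) :
    Representation F A (Fin 1 → F) :=
  ((algebraMap F (Module.End F (Fin 1 → F))).toMonoidHom).comp ((Units.coeHom F).comp χ)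

theorem polyAct_charRep {F : Type*} [Field F] {A : Type*} [CommGroup A] (χ : A →* Fˣ) (g : A)
    {f : MvPolynomial (Fin 1) F} {d : ℕ} (hf : f.IsHomogeneous d) :
    polyAct (charRep χ) g f = ((χ g).val ^ d) • f := by
  have hX : ∀ i, polyAct (charRep χ) g (X i) = C (χ g).val * X i := by
    intro i
    rw [polyAct_X', MvPolynomial.C_mul']
    fin_cases i
    simp [charRep, Module.algebraMap_end_apply]
  conv_lhs => rw [f.as_sum]
  conv_rhs => rw [f.as_sum]
  rw [map_sum, Finset.smul_sum]
  refine Finset.sum_congr rfl fun m hm => ?_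
  have hd : m 0 = d := by
    have := hf (mem_support_iff.1 hm)
    simpa [Finsupp.weight_apply, Finsupp.sum_fintype] using this
  have hmon : monomial m (coeff m f) = C (coeff m f) * X 0 ^ d := by
    rw [monomial_eq, Finsupp.prod_fintype _ _ (by simp)]
    simp [hd]
  rw [hmon, map_mul, map_pow, hX, algHom_C, algebraMap_eq, mul_pow, ← C_pow, smul_eq_C_mul]
  ring

theorem charRep_sigma_ge {F : Type*} [Field F] {A : Type*} [CommGroup A] (χ : A →* Fˣ)
    (he : 0 < orderOf χ) (d : ℕ)
    (hd : fgOver (invRing (charRep χ)) (Algebra.adjoin F (⋃ i ∈ Set.Iic d,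
      (subComp (invRing (charRep χ)) i : Set (MvPolynomial (Fin 1) F))))) :
    orderOf χ ≤ d := by
  by_contra! hlt
  have hbot : Algebra.adjoin F (⋃ i ∈ Set.Iic d,
      (subComp (invRing (charRep χ)) i : Set (MvPolynomial (Fin 1) F))) ≤ ⊥ := by
    refine Algebra.adjoin_le ?_
    intro f hf
    simp only [Set.mem_iUnion] at hf
    obtain ⟨i, hi, hf1, hf2⟩ := hf
    have hf2' : f.IsHomogeneous i := hf2
    rcases Nat.eq_zero_or_pos i with rfl | hpos
    · rw [← totalDegree_zero_iff_isHomogeneous, totalDegree_eq_zero_iff_eq_C] at hf2'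
      rw [hf2']
      exact Subalgebra.algebraMap_mem _ _
    · have hne : χ ^ i ≠ 1 := pow_ne_one_of_lt_orderOf hpos.ne' (lt_of_le_of_lt hi hlt)
      obtain ⟨g, hg⟩ : ∃ g, (χ ^ i) g ≠ 1 := by
        by_contra! h
        exact hne (MonoidHom.ext h)
      have h1 := (mem_invRing _ _).1 hf1 g
      rw [polyAct_charRep χ g hf2'] at h1
      have h2 : ((χ g).val ^ i - 1) • f = 0 := by rw [sub_smul, h1, one_smul, sub_self]
      rcases smul_eq_zero.1 h2 with h3 | h3
      · exact absurd (by ext; simpa [sub_eq_zero] using h3) hg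
      · rw [h3]; exact zero_mem _
  obtain ⟨B, -, hB⟩ := hd
  set N := B.sup totalDegree with hN
  have hmem : (X 0 : MvPolynomial (Fin 1) F) ^ (orderOf χ * (N + 1)) ∈ invRing (charRep χ) := by
    rw [mem_invRing]
    intro g
    rw [polyAct_charRep χ g (isHomogeneous_X_pow _ _), pow_mul, ← Units.val_pow_eq_pow_val,
      ← MonoidHom.pow_apply, pow_orderOf_eq_one]
    simp
  have h2 := hB.trans (mul_le_mul_left (show _ ≤ Subalgebra.toSubmodule ⊥ from hbot) _) hmem
  rw [Algebra.toSubmodule_bot, one_mul] at h2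
  have h3 : Submodule.span F (B : Set (MvPolynomial (Fin 1) F)) ≤ restrictTotalDegree (Fin 1) F N := by
    refine Submodule.span_le.2 fun b hb => ?_
    rw [SetLike.mem_coe, mem_restrictTotalDegree]
    exact Finset.le_sup (f := totalDegree) hb
  have h4 := h3 h2
  rw [mem_restrictTotalDegree, totalDegree_X_pow] at h4
  nlinarith

end SigmaHelpers

/-- For a nontrivial finite abelian group `A` over an algebraically closed field of
characteristic not dividing `|A|`, `σ(A) = exp(A)`. -/
theorem sigmaGrp_abelian_eq_exponent {F : Type*} [Field F] [IsAlgClosed F]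
    {A : Type*} [CommGroup A] [Finite A] [Nontrivial A] (hA : (Nat.card A : F) ≠ 0) :
    (∀ (n : ℕ) (ρ : Representation F A (Fin n → F)),
        sigmaAlg (invRing ρ) ≤ Monoid.exponent A) ∧
      ∃ (n : ℕ) (ρ : Representation F A (Fin n → F)),
        sigmaAlg (invRing ρ) = Monoid.exponent A := by
  refine ⟨fun n ρ => Nat.sInf_le (fgOver_exponent hA ρ), ?_⟩
  obtain ⟨e⟩ := finite_chars (F := F) hA
  obtain ⟨a, ha⟩ := Monoid.exists_orderOf_eq_exponent
    (Monoid.ExponentExists.of_finite (G := A))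
  have ho : orderOf (e.symm a) = Monoid.exponent A := by
    rw [← ha, MulEquiv.orderOf_eq]
  refine ⟨1, charRep (e.symm a), le_antisymm (Nat.sInf_le (fgOver_exponent hA _)) ?_⟩
  refine le_csInf ⟨_, fgOver_exponent hA _⟩ fun d hd => ?_
  rw [← ho]
  refine charRep_sigma_ge _ ?_ d hd
  rw [ho]
  exact Nat.pos_of_ne_zero Monoid.exponent_ne_zero_of_finite
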